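/- arXiv:1204.1084 — 7 statements merged into one kernel-verified Lean document; each statement's English description precedes it below -/
import Mathlib

section
/- Let H : Finset (Fin n) → ℝ be an m-body Hamiltonian with H(∅) = 0 (represented by coefficients c with c(∅) = 0 and c(T) = 0 for |T| > m), and let b be a state with |b| = k > m. Define a_m, …, a_1 by the downward recurrence a_m = 1 and a_p = 1 − Σ_{j=1}^{m−p} a_{p+j}·C(k−p, j) for 1 ≤ p < m. Then H(b) = Σ_{p=1}^{m} a_p · ( Σ_{d ⊆ b, |d| = p} H(d) ). -/
theorem count_between {n : ℕ} (T b : Finset (Fin n)) (hT : T ⊆ b) (p : ℕ) (hp : T.card ≤ p) :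
    ((b.powerset.filter (fun d => d.card = p)).filter (fun d => T ⊆ d)).card
      = (b.card - T.card).choose (p - T.card) := by
  rw [← Finset.card_sdiff_of_subset hT, ← Finset.card_powersetCard]
  refine Finset.card_nbij' (fun d => d \ T) (fun e => e ∪ T) ?_ ?_ ?_ ?_
  · intro d hd
    simp only [Finset.coe_filter, Finset.mem_filter, Finset.mem_powerset, Set.mem_ofPred_eq] at hd
    simp only [Finset.mem_coe, Finset.mem_powersetCard]
    refine ⟨Finset.sdiff_subset_sdiff hd.1.1 le_rfl, ?_⟩
    rw [Finset.card_sdiff_of_subset hd.2, hd.1.2]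
  · intro e he
    simp only [Finset.mem_coe, Finset.mem_powersetCard] at he
    simp only [Finset.coe_filter, Finset.mem_filter, Finset.mem_powerset, Set.mem_ofPred_eq]
    have hdis : Disjoint e T := Finset.disjoint_of_subset_left he.1 Finset.sdiff_disjoint
    refine ⟨⟨Finset.union_subset (he.1.trans Finset.sdiff_subset) hT, ?_⟩,
      Finset.subset_union_right⟩
    rw [Finset.card_union_of_disjoint hdis, he.2]
    omega
  · intro d hd
    simp only [Finset.coe_filter, Finset.mem_filter, Finset.mem_powerset, Set.mem_ofPred_eq] at hd
    exact Finset.sdiff_union_of_subset hd.2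
  · intro e he
    simp only [Finset.mem_coe, Finset.mem_powersetCard] at he
    have hdis : Disjoint e T := Finset.disjoint_of_subset_left he.1 Finset.sdiff_disjoint
    exact Finset.union_sdiff_cancel_right hdis

theorem coeff_one (m k : ℕ) (a : ℕ → ℝ) (ham : a m = 1)
    (harec : ∀ p : ℕ, 1 ≤ p → p < m →
      a p = 1 - ∑ j ∈ Finset.Icc 1 (m - p), a (p + j) * ((k - p).choose j : ℝ))
    (t : ℕ) (h1 : 1 ≤ t) (htm : t ≤ m) :
    ∑ p ∈ Finset.Icc t m, a p * ((k - t).choose (p - t) : ℝ) = 1 := by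
  have e1 : ∑ p ∈ Finset.Icc t m, a p * ((k - t).choose (p - t) : ℝ)
      = a t + ∑ j ∈ Finset.Icc 1 (m - t), a (t + j) * ((k - t).choose j : ℝ) := by
    have hA : Finset.Icc t m = Finset.Ico t (m + 1) := by ext; simp
    have hB : Finset.Icc 1 (m - t) = Finset.Ico 1 (m - t + 1) := by ext; simp
    rw [hA, hB, Finset.sum_Ico_eq_sum_range, Finset.sum_Ico_eq_sum_range,
      show m + 1 - t = (m - t) + 1 by omega, Finset.sum_range_succ']
    simp [add_comm]
  rw [e1]
  rcases htm.lt_or_eq with h | h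
  · rw [harec t h1 h]; ring
  · subst h; simp [ham]

/-- Let `H` be an `m`-body Hamiltonian with `H ∅ = 0`
(represented by coefficients `c` with `c ∅ = 0` and `c T = 0` for `|T| > m`),
and let `b` be a state of weight `k > m`.  If `a` satisfies the downward
recurrence `a m = 1`, `a p = 1 - ∑_{j=1}^{m-p} a (p+j) * C(k-p, j)` for
`1 ≤ p < m`, then `H b = ∑_{p=1}^{m} a p * (∑_{d ⊆ b, |d| = p} H d)`. -/
theorem mBody_descendant_expansion (n m : ℕ) (H c : Finset (Fin n) → ℝ)
    (hrep : ∀ S : Finset (Fin n), H S = ∑ T ∈ S.powerset, c T)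
    (hc0 : c ∅ = 0)
    (hcm : ∀ T : Finset (Fin n), T.card > m → c T = 0)
    (b : Finset (Fin n)) (k : ℕ) (hk : b.card = k) (hkm : k > m)
    (a : ℕ → ℝ) (ham : a m = 1)
    (harec : ∀ p : ℕ, 1 ≤ p → p < m →
      a p = 1 - ∑ j ∈ Finset.Icc 1 (m - p), a (p + j) * ((k - p).choose j : ℝ)) :
    H b = ∑ p ∈ Finset.Icc 1 m,
      a p * ∑ d ∈ b.powerset.filter (fun d => d.card = p), H d := by
  have key : ∀ p, ∑ d ∈ b.powerset.filter (fun d => d.card = p), H d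
      = ∑ T ∈ b.powerset,
        c T * (((b.powerset.filter (fun d => d.card = p)).filter (fun d => T ⊆ d)).card : ℝ) := by
    intro p
    have h1 : ∀ d ∈ b.powerset.filter (fun d => d.card = p),
        H d = ∑ T ∈ b.powerset, if T ⊆ d then c T else 0 := by
      intro d hd
      rw [hrep, ← Finset.sum_filter]
      refine Finset.sum_congr ?_ (fun _ _ => rfl)
      simp only [Finset.mem_filter, Finset.mem_powerset] at hd
      ext T
      simp only [Finset.mem_filter, Finset.mem_powerset]
      exact ⟨fun h => ⟨h.trans hd.1, h⟩, fun h => h.2⟩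
    rw [Finset.sum_congr rfl h1, Finset.sum_comm]
    refine Finset.sum_congr rfl (fun T _ => ?_)
    rw [← Finset.sum_filter, Finset.sum_const, nsmul_eq_mul, mul_comm]
  simp only [key, Finset.mul_sum]
  rw [Finset.sum_comm, hrep]
  refine Finset.sum_congr rfl (fun T hT => ?_)
  rw [Finset.mem_powerset] at hT
  by_cases h0 : T = ∅
  · simp [h0, hc0]
  by_cases hm : T.card > m
  · simp [hcm T hm]
  have ht1 : 1 ≤ T.card := Finset.card_pos.mpr (Finset.nonempty_iff_ne_empty.mpr h0)
  have hc := coeff_one m k a ham harec T.card ht1 (not_lt.mp hm)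
  have hsub : Finset.Icc T.card m ⊆ Finset.Icc 1 m := Finset.Icc_subset_Icc_left ht1
  rw [← Finset.sum_subset hsub]
  · calc c T = c T * 1 := (mul_one _).symm
      _ = _ := by
        rw [← hc, Finset.mul_sum]
        refine Finset.sum_congr rfl (fun p hp => ?_)
        rw [count_between T b hT p (Finset.mem_Icc.mp hp).1, hk]
        ring
  · intro p hp hp2
    have hlt : p < T.card := by
      simp only [Finset.mem_Icc] at hp hp2
      omega
    have : (b.powerset.filter (fun d => d.card = p)).filter (fun d => T ⊆ d) = ∅ := by
      refine Finset.filter_eq_empty_iff.mpr (fun d hd hTd => ?_)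
      have := Finset.card_le_card hTd
      have h2 := (Finset.mem_filter.mp hd).2
      omega
    simp [this]
end

section
/- Let H : Finset (Fin n) → ℝ be a Hamiltonian with H(∅) = 0, and let m ≥ 1. Suppose that for every state b with |b| = k > m one has H(b) = Σ_{p=1}^{m} a_p · ( Σ_{d ⊆ b, |d| = p} H(d) ), where a_m, …, a_1 are defined (depending on k) by a_m = 1 and a_p = 1 − Σ_{j=1}^{m−p} a_{p+j}·C(k−p, j) for 1 ≤ p < m. Then H is m-body, i.e. the coefficients c representing H satisfy c(T) = 0 whenever |T| > m. -/
noncomputable def aAux (k m : ℕ) : ℕ → ℝ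
  | i => 1 - ∑ j ∈ (Finset.Icc 1 i).attach,
      aAux k m (i - j.1) * ((k - (m - i)).choose j.1 : ℝ)
  decreasing_by
    have := Finset.mem_Icc.1 j.2
    omega

lemma aAux_eq (k m i : ℕ) : aAux k m i = 1 - ∑ j ∈ Finset.Icc 1 i,
      aAux k m (i - j) * ((k - (m - i)).choose j : ℝ) := by
  rw [aAux, Finset.sum_attach (Finset.Icc 1 i)
    (fun j => aAux k m (i - j) * ((k - (m - i)).choose j : ℝ))]

lemma count_aux {n : ℕ} (b T : Finset (Fin n)) (hT : T ⊆ b) (p : ℕ) (hp : T.card ≤ p) :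
    ((b.powerset.filter (fun d => d.card = p)).filter (fun d => T ⊆ d)).card
      = (b.card - T.card).choose (p - T.card) := by
  rw [← Finset.card_sdiff_of_subset hT, ← Finset.card_powersetCard]
  symm
  apply Finset.card_bij (fun e _ => e ∪ T)
  · intro e he
    rw [Finset.mem_powersetCard] at he
    have hd : Disjoint e T := (Finset.subset_sdiff.1 he.1).2
    simp only [Finset.mem_filter, Finset.mem_powerset]
    refine ⟨⟨Finset.union_subset (Finset.subset_sdiff.1 he.1).1 hT, ?_⟩,
      Finset.subset_union_right⟩
    rw [Finset.card_union_of_disjoint hd, he.2]; omega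
  · intro e he f hf h
    rw [Finset.mem_powersetCard] at he hf
    have h1 : Disjoint e T := (Finset.subset_sdiff.1 he.1).2
    have h2 : Disjoint f T := (Finset.subset_sdiff.1 hf.1).2
    rw [← Finset.union_sdiff_cancel_right h1, ← Finset.union_sdiff_cancel_right h2]
    exact congrArg (· \ T) h
  · intro d hd
    simp only [Finset.mem_filter, Finset.mem_powerset] at hd
    refine ⟨d \ T, ?_, Finset.sdiff_union_of_subset hd.2⟩
    rw [Finset.mem_powersetCard, Finset.card_sdiff_of_subset hd.2, hd.1.2]
    exact ⟨Finset.sdiff_subset_sdiff hd.1.1 subset_rfl, rfl⟩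

lemma swap_aux {n : ℕ} (c : Finset (Fin n) → ℝ) (b : Finset (Fin n)) (p : ℕ) :
    ∑ d ∈ b.powerset.filter (fun d => d.card = p), ∑ T ∈ d.powerset, c T
      = ∑ T ∈ b.powerset, c T *
        (if T.card ≤ p then ((b.card - T.card).choose (p - T.card) : ℝ) else 0) := by
  rw [Finset.sum_comm' (t' := b.powerset)
    (s' := fun T => (b.powerset.filter (fun d => d.card = p)).filter (fun d => T ⊆ d))]
  · apply Finset.sum_congr rfl
    intro T hT
    rw [Finset.sum_const, nsmul_eq_mul, mul_comm]
    congr 1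
    split_ifs with h
    · rw [count_aux b T (Finset.mem_powerset.1 hT) p h]
    · rw [Nat.cast_eq_zero, Finset.card_eq_zero, Finset.filter_eq_empty_iff]
      intro d hd hTd
      have := Finset.card_le_card hTd
      have := (Finset.mem_filter.1 hd).2
      omega
  · intro d T
    simp only [Finset.mem_filter, Finset.mem_powerset]
    constructor
    · rintro ⟨h1, h2⟩
      exact ⟨⟨h1, h2⟩, h2.trans h1.1⟩
    · rintro ⟨⟨h1, h2⟩, _⟩
      exact ⟨h1, h2⟩

/-- **converse.** Let `H` be a Hamiltonian with `H ∅ = 0`, `m ≥ 1`.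
Suppose for every state `b` of weight `k > m` the descendant expansion
`H b = ∑_{p=1}^{m} a p * (∑_{d ⊆ b, |d| = p} H d)` holds, where `a` (depending
on `k`) satisfies `a m = 1` and `a p = 1 - ∑_{j=1}^{m-p} a (p+j) * C(k-p, j)`
for `1 ≤ p < m`.  Then `H` is `m`-body: any coefficients `c` representing `H`
vanish on sets of cardinality greater than `m`. -/
theorem mBody_of_descendant_expansion (n m : ℕ) (hm : 1 ≤ m)
    (H : Finset (Fin n) → ℝ) (h0 : H ∅ = 0)
    (hexp : ∀ b : Finset (Fin n), b.card > m →
      ∀ a : ℕ → ℝ, a m = 1 →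
      (∀ p : ℕ, 1 ≤ p → p < m →
        a p = 1 - ∑ j ∈ Finset.Icc 1 (m - p), a (p + j) * ((b.card - p).choose j : ℝ)) →
      H b = ∑ p ∈ Finset.Icc 1 m,
        a p * ∑ d ∈ b.powerset.filter (fun d => d.card = p), H d) :
    ∀ c : Finset (Fin n) → ℝ,
      (∀ S : Finset (Fin n), H S = ∑ T ∈ S.powerset, c T) →
      ∀ T : Finset (Fin n), T.card > m → c T = 0 := by
  intro c hc
  have hc0 : c ∅ = 0 := by
    have := hc ∅
    rw [h0] at this
    simpa using this.symm
  have key : ∀ b : Finset (Fin n), b.card > m →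
      ∑ T ∈ b.powerset, c T = ∑ T ∈ b.powerset, (if T.card ≤ m then c T else 0) := by
    intro b hb
    have ha : ∀ p : ℕ, 1 ≤ p → p ≤ m →
        aAux b.card m (m - p) = 1 - ∑ j ∈ Finset.Icc 1 (m - p),
          aAux b.card m (m - (p + j)) * ((b.card - p).choose j : ℝ) := by
      intro p h1 h2
      rw [aAux_eq]
      congr 1
      apply Finset.sum_congr rfl
      intro j _
      rw [Nat.sub_sub, Nat.sub_sub_self h2]
    have h := hexp b hb (fun p => aAux b.card m (m - p)) (by
      have := aAux_eq b.card m 0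
      simpa using this) (fun p h1 h2 => ha p h1 h2.le)
    rw [← hc b, h]
    simp_rw [hc, swap_aux c b, Finset.mul_sum]
    rw [Finset.sum_comm]
    apply Finset.sum_congr rfl
    intro T hT
    by_cases hT0 : T = ∅
    · subst hT0; simp [hc0]
    have hT1 : 1 ≤ T.card := Finset.card_pos.2 (Finset.nonempty_iff_ne_empty.2 hT0)
    split_ifs with hTm
    · have e : ∀ p ∈ Finset.Icc 1 m, aAux b.card m (m - p) * (c T *
          (if T.card ≤ p then ((b.card - T.card).choose (p - T.card) : ℝ) else 0)) =
          c T * (if T.card ≤ p then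
            aAux b.card m (m - p) * ((b.card - T.card).choose (p - T.card) : ℝ) else 0) := by
        intro p _
        split_ifs <;> ring
      rw [Finset.sum_congr rfl e, ← Finset.mul_sum, ← Finset.sum_filter]
      have e2 : (Finset.Icc 1 m).filter (fun p => T.card ≤ p)
          = (Finset.range (m - T.card + 1)).image (fun j => T.card + j) := by
        ext p
        simp only [Finset.mem_filter, Finset.mem_Icc, Finset.mem_image, Finset.mem_range]
        constructor
        · rintro ⟨h1, h2⟩
          exact ⟨p - T.card, by omega, by omega⟩
        · rintro ⟨j, h1, h2⟩
          omega
      rw [e2, Finset.sum_image (by intro x _ y _ h; simpa using h)]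
      have e3 : Finset.range (m - T.card + 1) = insert 0 (Finset.Icc 1 (m - T.card)) := by
        ext p
        simp only [Finset.mem_insert, Finset.mem_Icc, Finset.mem_range]
        omega
      rw [e3, Finset.sum_insert (by simp)]
      have h3 := ha T.card hT1 hTm
      simp only [Nat.add_sub_cancel_left, add_zero, Nat.sub_self, Nat.choose_zero_right,
        Nat.cast_one, mul_one]
      rw [h3]
      ring
    · apply Finset.sum_eq_zero
      intro p hp
      have := (Finset.mem_Icc.1 hp).2
      rw [if_neg (by omega)]
      ring
  intro T
  induction T using Finset.strongInduction with
  | H T ih =>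
    intro hT
    have h := key T hT
    rw [← sub_eq_zero, ← Finset.sum_sub_distrib, Finset.sum_eq_single T] at h
    · rw [if_neg (by omega)] at h
      simpa using h
    · intro S hS hne
      split_ifs with hs
      · ring
      · rw [ih S ((Finset.mem_powerset.1 hS).ssubset_of_ne hne) (by omega)]
        ring
    · intro hn
      simp at hn
end

section
/- For integers k > m ≥ 1, define a_m, …, a_1 ∈ ℝ by the downward recurrence a_m = 1 and a_p = 1 − Σ_{j=1}^{m−p} a_{p+j}·C(k−p, j) for 1 ≤ p < m. Then the coefficients a_p alternate in sign: (−1)^{m−p} · a_p > 0 for every p with 1 ≤ p ≤ m. -/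
theorem aux_vander (M n : ℕ) (hM : 1 ≤ M) :
    ∑ j ∈ Finset.range (n + 1), (-1 : ℝ) ^ (n - j) * ((M + (n - j) - 1).choose (n - j) : ℝ)
      * ((M + n).choose j : ℝ) = 1 := by
  have hneg : ∀ i : ℕ, Ring.choose (-(M : ℤ)) i = (-1 : ℤ) ^ i * ((M + i - 1).choose i : ℤ) := by
    intro i
    rw [Ring.choose_neg]
    have : (M : ℤ) + i - 1 = ((M + i - 1 : ℕ) : ℤ) := by omega
    rw [this, Ring.choose_natCast]
    simp [Units.smul_def, Int.negOnePow_def]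
  have h := Ring.add_choose_eq n (Commute.all ((M + n : ℕ) : ℤ) (-(M : ℤ)))
  have h0 : ((M + n : ℕ) : ℤ) + -(M : ℤ) = (n : ℕ) := by push_cast; ring
  rw [h0, Ring.choose_natCast, Finset.Nat.sum_antidiagonal_eq_sum_range_succ_mk] at h
  simp only [hneg, Ring.choose_natCast, Nat.choose_self] at h
  have h' := congrArg (Int.cast : ℤ → ℝ) h
  push_cast at h'
  refine Eq.trans ?_ h'.symm
  refine Finset.sum_congr rfl fun j _ => ?_
  ring

/-- For integers `k > m ≥ 1`, the coefficients defined by the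
downward recurrence `a m = 1`, `a p = 1 - ∑_{j=1}^{m-p} a (p+j) * C(k-p, j)`
for `1 ≤ p < m`, alternate in sign: `(-1)^(m-p) * a p > 0` for `1 ≤ p ≤ m`. -/
theorem recurrence_coefficients_alternate (k m : ℕ) (hm : 1 ≤ m) (hk : m < k)
    (a : ℕ → ℝ) (ham : a m = 1)
    (harec : ∀ p : ℕ, 1 ≤ p → p < m →
      a p = 1 - ∑ j ∈ Finset.Icc 1 (m - p), a (p + j) * ((k - p).choose j : ℝ)) :
    ∀ p : ℕ, 1 ≤ p → p ≤ m → (-1 : ℝ) ^ (m - p) * a p > 0 := by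
  have key : ∀ n p : ℕ, 1 ≤ p → p + n = m →
      a p = (-1 : ℝ) ^ n * (((k - m) + n - 1).choose n : ℝ) := by
    intro n
    induction n using Nat.strong_induction_on with
    | _ n ih =>
      intro p hp hpn
      rcases Nat.eq_zero_or_pos n with rfl | hn
      · have : p = m := by omega
        simp [this, ham]
      · have hv := aux_vander (k - m) n (by omega)
        have hr := harec p hp (by omega)
        rw [Finset.sum_range_eq_add_Ico _ (by omega)] at hv
        have e : Finset.Icc 1 (m - p) = Finset.Ico 1 (n + 1) := by
          ext x; simp only [Finset.mem_Icc, Finset.mem_Ico]; omega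
        rw [e] at hr
        have hs : ∑ j ∈ Finset.Ico 1 (n + 1), a (p + j) * ((k - p).choose j : ℝ)
            = ∑ j ∈ Finset.Ico 1 (n + 1), (-1 : ℝ) ^ (n - j) *
              (((k - m) + (n - j) - 1).choose (n - j) : ℝ) * (((k - m) + n).choose j : ℝ) := by
          refine Finset.sum_congr rfl fun j hj => ?_
          rw [Finset.mem_Ico] at hj
          rw [ih (n - j) (by omega) (p + j) (by omega) (by omega),
            show k - p = k - m + n by omega]
        rw [hs] at hr
        simp only [Nat.sub_zero, Nat.choose_zero_right, Nat.cast_one, mul_one] at hv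
        linarith
  intro p hp hpm
  rw [key (m - p) p hp (by omega), ← mul_assoc, ← mul_pow]
  have : 0 < ((k - m) + (m - p) - 1).choose (m - p) := Nat.choose_pos (by omega)
  simpa using this
end

section
/- Let n ≥ 2 and let H : Finset (Fin n) → ℝ be an (n−1)-body Hamiltonian with H(∅) = 0 and H(S) ≥ 0 for every state S, and let G = {S : H(S) = 0}. Then every nonempty state of weight congruent to n modulo 2 lies in G if and only if every nonempty state of weight not congruent to n modulo 2 lies in G. In particular, any set of ground states violating this equivalence can only be synthesized by a Hamiltonian in which all n spins interact together. -/
theorem alt_sum_aux (n : ℕ) (T : Finset (Fin n)) (a : Fin n) (ha : a ∉ T) :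
    ∑ S : Finset (Fin n), (if T ⊆ S then (-1 : ℝ) ^ S.card else 0) = 0 := by
  refine Finset.sum_involution (fun S _ => if a ∈ S then S.erase a else insert a S) ?_ ?_ ?_ ?_
  · intro S _
    by_cases h : a ∈ S
    · have h1 : T ⊆ S.erase a ↔ T ⊆ S := by
        rw [Finset.subset_erase]; tauto
      have h2 := Finset.card_erase_add_one h
      simp only [h, if_true, h1]
      rw [← h2]
      split_ifs <;> ring
    · have h1 : T ⊆ insert a S ↔ T ⊆ S := Finset.subset_insert_iff_of_notMem ha
      simp only [h, if_false, h1]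
      rw [Finset.card_insert_of_notMem h]
      split_ifs <;> ring
  · intro S _ _ h
    by_cases hS : a ∈ S
    · simp only [hS, if_true] at h
      rw [← h] at hS
      simp at hS
    · simp only [hS, if_false] at h
      rw [← h] at hS
      simp at hS
  · intro S _
    simp
  · intro S _
    by_cases hS : a ∈ S <;> simp [hS]

theorem alt_sum_H (n : ℕ) (hn : 2 ≤ n)
    (H c : Finset (Fin n) → ℝ)
    (hrep : ∀ S : Finset (Fin n), H S = ∑ T ∈ S.powerset, c T)
    (hcm : ∀ T : Finset (Fin n), T.card > n - 1 → c T = 0) :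
    ∑ S : Finset (Fin n), (-1 : ℝ) ^ S.card * H S = 0 := by
  have h1 : ∀ S : Finset (Fin n), (-1 : ℝ) ^ S.card * H S
      = ∑ T : Finset (Fin n), c T * (if T ⊆ S then (-1 : ℝ) ^ S.card else 0) := by
    intro S
    have : S.powerset = Finset.univ.filter (fun T => T ⊆ S) := by ext; simp
    rw [hrep, this, Finset.sum_filter, Finset.mul_sum]
    refine Finset.sum_congr rfl fun T _ => ?_
    split_ifs <;> ring
  simp_rw [h1]
  rw [Finset.sum_comm]
  refine Finset.sum_eq_zero fun T _ => ?_
  rw [← Finset.mul_sum]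
  by_cases hT : T = Finset.univ
  · rw [hcm T (by rw [hT]; simp; omega)]; simp
  · obtain ⟨a, ha⟩ : ∃ a, a ∉ T := by
      by_contra! h
      exact hT (Finset.eq_univ_iff_forall.2 h)
    rw [alt_sum_aux n T a ha, mul_zero]

theorem sign_aux (n : ℕ) (H : Finset (Fin n) → ℝ) (e : ℝ) (he : e ≠ 0)
    (hs : ∑ S : Finset (Fin n), (-1 : ℝ) ^ S.card * H S = 0)
    (hpos : ∀ S, 0 ≤ H S) (h : ∀ S, (-1 : ℝ) ^ S.card = e ∨ H S = 0) :
    ∀ S, H S = 0 := by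
  have h2 : ∑ S : Finset (Fin n), e * H S = 0 := by
    rw [← hs]
    refine Finset.sum_congr rfl fun S _ => ?_
    rcases h S with h | h <;> simp [h]
  rw [← Finset.mul_sum] at h2
  have h3 := (mul_eq_zero.1 h2).resolve_left he
  intro S
  exact (Finset.sum_eq_zero_iff_of_nonneg (fun S _ => hpos S)).1 h3 S (Finset.mem_univ S)

theorem pow_par (a b : ℕ) (h : a % 2 = b % 2) : (-1 : ℝ) ^ a = (-1) ^ b := by
  rw [neg_one_pow_eq_pow_mod_two, h, ← neg_one_pow_eq_pow_mod_two]

/-- Let `n ≥ 2` and let `H` be an `(n-1)`-body Hamiltonian with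
`H ∅ = 0` and `H S ≥ 0` for every state `S`; let `G = {S : H S = 0}`.  Then all
nonempty states of weight congruent to `n` mod 2 lie in `G` iff all nonempty
states of weight not congruent to `n` mod 2 lie in `G`. -/
theorem whole_body_parity_constraint (n : ℕ) (hn : 2 ≤ n)
    (H c : Finset (Fin n) → ℝ)
    (hrep : ∀ S : Finset (Fin n), H S = ∑ T ∈ S.powerset, c T)
    (hcm : ∀ T : Finset (Fin n), T.card > n - 1 → c T = 0)
    (h0 : H ∅ = 0)
    (hpos : ∀ S : Finset (Fin n), 0 ≤ H S)
    (G : Set (Finset (Fin n))) (hG : G = {S | H S = 0}) :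
    (∀ S : Finset (Fin n), S ≠ ∅ → S.card % 2 = n % 2 → S ∈ G) ↔
    (∀ S : Finset (Fin n), S ≠ ∅ → S.card % 2 ≠ n % 2 → S ∈ G) := by
  have hs := alt_sum_H n hn H c hrep hcm
  subst hG
  simp only [Set.mem_setOf_eq]
  constructor
  · intro h S _ _
    refine sign_aux n H ((-1) ^ (n + 1)) (by simp) hs hpos (fun S => ?_) S
    by_cases hS : S = ∅
    · right; rw [hS, h0]
    by_cases hp : S.card % 2 = n % 2
    · exact Or.inr (h S hS hp)
    · exact Or.inl (pow_par _ _ (by omega))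
  · intro h S _ _
    refine sign_aux n H ((-1) ^ n) (by simp) hs hpos (fun S => ?_) S
    by_cases hS : S = ∅
    · right; rw [hS, h0]
    by_cases hp : S.card % 2 = n % 2
    · exact Or.inl (pow_par _ _ hp)
    · exact Or.inr (h S hS hp)
end

section
/- (Lemma on three-spin synthesis.) Let G be a set of states of a system of 3 spins with ∅ ∈ G. There exists a 2-body Hamiltonian H : Finset (Fin 3) → ℝ with H(S) ≥ 0 for all S and {S : H(S) = 0} = G if and only if the following equivalence holds: {{0,1,2}, {0}, {1}, {2}} ⊆ G if and only if {{0,1}, {0,2}, {1,2}} ⊆ G. -/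
theorem fs_cases (S : Finset (Fin 3)) : S = ∅ ∨ S = {0} ∨ S = {1} ∨ S = {2} ∨ S = {0, 1} ∨
    S = {0, 2} ∨ S = {1, 2} ∨ S = {0, 1, 2} := by
  revert S; decide

theorem sum1 (i : Fin 3) (f : Finset (Fin 3) → ℝ) :
    ∑ T ∈ ({i} : Finset (Fin 3)).powerset, f T = f ∅ + f {i} := by
  have h := Finset.sum_powerset_insert (a := i) (s := ∅) (by simp) f
  simpa using h

theorem sum2 (i j : Fin 3) (hij : i ≠ j) (f : Finset (Fin 3) → ℝ) :
    ∑ T ∈ ({i, j} : Finset (Fin 3)).powerset, f T = f ∅ + f {j} + (f {i} + f {i, j}) := by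
  rw [Finset.sum_powerset_insert (by simpa using hij), sum1, sum1 j (fun t => f (insert i t))]
  simp

theorem sum3 (f : Finset (Fin 3) → ℝ) :
    ∑ T ∈ ({0, 1, 2} : Finset (Fin 3)).powerset, f T =
      f ∅ + f {2} + (f {1} + f {1, 2}) + (f {0} + f {0, 2} + (f {0, 1} + f {0, 1, 2})) := by
  rw [Finset.sum_powerset_insert (by decide), sum2 1 2 (by decide),
    sum2 1 2 (by decide) (fun t => f (insert 0 t))]
  simp

theorem exists_c (H : Finset (Fin 3) → ℝ) (h0 : H ∅ = 0)
    (h : H {0, 1, 2} + H {0} + H {1} + H {2} = H {0, 1} + H {0, 2} + H {1, 2}) :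
    ∃ c : Finset (Fin 3) → ℝ, (∀ S : Finset (Fin 3), H S = ∑ T ∈ S.powerset, c T) ∧
      (∀ T : Finset (Fin 3), T.card > 2 → c T = 0) := by
  refine ⟨fun T => if T.card = 1 then H T else
    if T.card = 2 then H T - ∑ i ∈ T, H {i} else 0, ?_, ?_⟩
  · intro S
    have c01 : ({0, 1} : Finset (Fin 3)).card = 2 := by decide
    have c02 : ({0, 2} : Finset (Fin 3)).card = 2 := by decide
    have c12 : ({1, 2} : Finset (Fin 3)).card = 2 := by decide
    have c3 : ({0, 1, 2} : Finset (Fin 3)).card = 3 := by decide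
    have s01 := Finset.sum_pair (f := fun i : Fin 3 => H {i}) (show (0 : Fin 3) ≠ 1 by decide)
    have s02 := Finset.sum_pair (f := fun i : Fin 3 => H {i}) (show (0 : Fin 3) ≠ 2 by decide)
    have s12 := Finset.sum_pair (f := fun i : Fin 3 => H {i}) (show (1 : Fin 3) ≠ 2 by decide)
    rcases fs_cases S with rfl | rfl | rfl | rfl | rfl | rfl | rfl | rfl
    · simp [h0]
    · rw [sum1]; simp
    · rw [sum1]; simp
    · rw [sum1]; simp
    · rw [sum2 _ _ (by decide), c01, s01]; simp; ring
    · rw [sum2 _ _ (by decide), c02, s02]; simp; ring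
    · rw [sum2 _ _ (by decide), c12, s12]; simp; ring
    · rw [sum3, c01, c02, c12, c3, s01, s02, s12]; simp; linarith
  · intro T hT
    simp only
    rw [if_neg (by omega), if_neg (by omega)]

/-- **Lemma on three-spin synthesis.** Let `G` be a set of states
of three spins with `∅ ∈ G`.  There is a 2-body Hamiltonian `H` which is
nonnegative with `{S : H S = 0} = G` iff
`{{0,1,2}, {0}, {1}, {2}} ⊆ G ↔ {{0,1}, {0,2}, {1,2}} ⊆ G`. -/
theorem three_spin_synthesis (G : Set (Finset (Fin 3))) (h0 : (∅ : Finset (Fin 3)) ∈ G) :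
    (∃ (H c : Finset (Fin 3) → ℝ),
      (∀ S : Finset (Fin 3), H S = ∑ T ∈ S.powerset, c T) ∧
      (∀ T : Finset (Fin 3), T.card > 2 → c T = 0) ∧
      (∀ S : Finset (Fin 3), 0 ≤ H S) ∧
      {S : Finset (Fin 3) | H S = 0} = G) ↔
    (({({0, 1, 2} : Finset (Fin 3)), {0}, {1}, {2}} : Set (Finset (Fin 3))) ⊆ G ↔
      ({({0, 1} : Finset (Fin 3)), {0, 2}, {1, 2}} : Set (Finset (Fin 3))) ⊆ G) := by
  classical
  constructor
  · rintro ⟨H, c, hH, hc, hp, rfl⟩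
    simp only [Set.insert_subset_iff, Set.singleton_subset_iff, Set.mem_setOf_eq] at h0 ⊢
    have e : H {0, 1, 2} + H {0} + H {1} + H {2} = H {0, 1} + H {0, 2} + H {1, 2} := by
      have e0 := hH ∅
      simp only [Finset.powerset_empty, Finset.sum_singleton] at e0
      have := hc {0, 1, 2} (by decide)
      rw [hH {0, 1, 2}, hH {0}, hH {1}, hH {2}, hH {0, 1}, hH {0, 2}, hH {1, 2}, sum3, sum1, sum1,
        sum1, sum2 _ _ (by decide), sum2 _ _ (by decide), sum2 _ _ (by decide)]
      linarith
    have := hp {0, 1, 2}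
    have := hp {0}
    have := hp {1}
    have := hp {2}
    have := hp {0, 1}
    have := hp {0, 2}
    have := hp {1, 2}
    constructor
    · rintro ⟨h1, h2, h3, h4⟩
      refine ⟨?_, ?_, ?_⟩ <;> linarith
    · rintro ⟨h1, h2, h3⟩
      refine ⟨?_, ?_, ?_, ?_⟩ <;> linarith
  · intro h
    simp only [Set.insert_subset_iff, Set.singleton_subset_iff] at h
    obtain ⟨u, hu⟩ : ∃ u : Finset (Fin 3) → ℝ, u = fun S => if S ∈ G then 0 else 1 := ⟨_, rfl⟩
    have hu0 : ∀ S, 0 ≤ u S := by intro S; rw [hu]; dsimp only; split_ifs <;> norm_num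
    have huG : ∀ S, u S = 0 ↔ S ∈ G := by intro S; rw [hu]; simp
    clear hu
    simp only [← huG] at h h0
    obtain ⟨A, hA⟩ : ∃ A, A = u {0, 1, 2} + u {0} + u {1} + u {2} := ⟨_, rfl⟩
    obtain ⟨B, hB⟩ : ∃ B, B = u {0, 1} + u {0, 2} + u {1, 2} := ⟨_, rfl⟩
    have p012 := hu0 {0, 1, 2}
    have p0 := hu0 {0}
    have p1 := hu0 {1}
    have p2 := hu0 {2}
    have p01 := hu0 {0, 1}
    have p02 := hu0 {0, 2}
    have p12 := hu0 {1, 2}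
    have hAn : 0 ≤ A := by linarith
    have hBn : 0 ≤ B := by linarith
    have hBA : B = 0 → A = 0 := by
      intro hz
      obtain ⟨a, b, c, d⟩ := h.2 ⟨by linarith, by linarith, by linarith⟩
      linarith
    have hAB : A = 0 → B = 0 := by
      intro hz
      obtain ⟨a, b, c⟩ := h.1 ⟨by linarith, by linarith, by linarith, by linarith⟩
      linarith
    obtain ⟨H, hH⟩ : ∃ H : Finset (Fin 3) → ℝ,
      H = fun S => u S * (if S.card % 2 = 1 then B else A) := ⟨_, rfl⟩
    have v012 : H {0, 1, 2} = u {0, 1, 2} * B := by rw [hH]; exact congrArg _ (if_pos (by decide))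
    have v0 : H {0} = u {0} * B := by rw [hH]; exact congrArg _ (if_pos (by decide))
    have v1 : H {1} = u {1} * B := by rw [hH]; exact congrArg _ (if_pos (by decide))
    have v2 : H {2} = u {2} * B := by rw [hH]; exact congrArg _ (if_pos (by decide))
    have v01 : H {0, 1} = u {0, 1} * A := by rw [hH]; exact congrArg _ (if_neg (by decide))
    have v02 : H {0, 2} = u {0, 2} * A := by rw [hH]; exact congrArg _ (if_neg (by decide))
    have v12 : H {1, 2} = u {1, 2} * A := by rw [hH]; exact congrArg _ (if_neg (by decide))
    have ve : H ∅ = 0 := by rw [hH]; simp [h0]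
    obtain ⟨c, hc1, hc2⟩ := exists_c H ve (by
      rw [v012, v0, v1, v2, v01, v02, v12]
      have e1 : (u {0, 1, 2} + u {0} + u {1} + u {2}) * B = A * B := by rw [hA]
      have e2 : (u {0, 1} + u {0, 2} + u {1, 2}) * A = B * A := by rw [hB]
      linarith)
    refine ⟨H, c, hc1, hc2, ?_, ?_⟩
    · intro S
      rw [hH]
      dsimp only
      split_ifs
      · exact mul_nonneg (hu0 S) hBn
      · exact mul_nonneg (hu0 S) hAn
    · ext S
      rw [Set.mem_setOf_eq, ← huG]
      constructor
      · rcases fs_cases S with rfl | rfl | rfl | rfl | rfl | rfl | rfl | rfl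
        · exact fun _ => h0
        · rw [v0, mul_eq_zero]; rintro (hz | hz)
          · exact hz
          · have := hBA hz; linarith
        · rw [v1, mul_eq_zero]; rintro (hz | hz)
          · exact hz
          · have := hBA hz; linarith
        · rw [v2, mul_eq_zero]; rintro (hz | hz)
          · exact hz
          · have := hBA hz; linarith
        · rw [v01, mul_eq_zero]; rintro (hz | hz)
          · exact hz
          · have := hAB hz; linarith
        · rw [v02, mul_eq_zero]; rintro (hz | hz)
          · exact hz
          · have := hAB hz; linarith
        · rw [v12, mul_eq_zero]; rintro (hz | hz)
          · exact hz
          · have := hAB hz; linarith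
        · rw [v012, mul_eq_zero]; rintro (hz | hz)
          · exact hz
          · have := hBA hz; linarith
      · intro hz
        rw [hH]
        simp [hz]
end

section
/- (Universality of 2-body ground states.) For every n and every Boolean function f : (Fin n → Bool) → Bool, there exist a number N of ancilla spins and a 2-body Hamiltonian H on the n + N + 1 spins (the first n spins being inputs, the next N being ancillae, and the last being the output) — that is, a function H : Finset (Fin (n+N+1)) → ℝ represented by coefficients c with c(T) = 0 for |T| > 2 — such that H(S) ≥ 0 for every state S, and for every input assignment x : Fin n → Bool and output bit z : Bool: there exists an ancilla assignment s : Fin N → Bool with H(state(x,s,z)) = 0 if and only if z = f(x). Here state(x,s,z) denotes the Finset of spins set to 1 under the assignment (x,s,z). -/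
/-- The bit assigned to spin `i` of a system of `n + N + 1` spins, where the
first `n` spins carry the input `x`, the next `N` spins carry the ancilla
assignment `s`, and the last spin carries the output bit `z`. -/
def assignBit {n N : ℕ} (x : Fin n → Bool) (s : Fin N → Bool) (z : Bool)
    (i : Fin (n + N + 1)) : Bool :=
  if h : (i : ℕ) < n then x ⟨i, h⟩
  else if h' : (i : ℕ) < n + N then s ⟨(i : ℕ) - n, by omega⟩
  else z

/-- `stateOf x s z` is the state (set of spins in state 1) corresponding to the
assignment `(x, s, z)`. -/
def stateOf {n N : ℕ} (x : Fin n → Bool) (s : Fin N → Bool) (z : Bool) :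
    Finset (Fin (n + N + 1)) :=
  Finset.univ.filter (fun i => assignBit x s z i = true)


/-- indicator of `T ⊆ S` -/
def chiF {k : ℕ} (T : Finset (Fin k)) : Finset (Fin k) → ℝ := fun S => if T ⊆ S then 1 else 0

def bodyV (k d : ℕ) : Submodule ℝ (Finset (Fin k) → ℝ) :=
  Submodule.span ℝ (chiF '' {T | T.card ≤ d})

lemma chiF_mem {k d : ℕ} (T : Finset (Fin k)) (h : T.card ≤ d) : chiF T ∈ bodyV k d :=
  Submodule.subset_span ⟨T, h, rfl⟩

lemma bodyV_mul {k : ℕ} {L M : Finset (Fin k) → ℝ} (hL : L ∈ bodyV k 1) (hM : M ∈ bodyV k 1) :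
    L * M ∈ bodyV k 2 := by
  have h := Submodule.mul_mem_mul hL hM
  unfold bodyV at h
  rw [Submodule.span_mul_span] at h
  refine Submodule.span_le.2 ?_ h
  rintro _ ⟨_, ⟨T, hT, rfl⟩, _, ⟨U, hU, rfl⟩, rfl⟩
  have : chiF T * chiF U = chiF (T ∪ U) := by
    funext S
    simp only [chiF, Pi.mul_apply, Finset.union_subset_iff]
    split_ifs <;> simp_all
  simp only [this]
  refine chiF_mem _ ((Finset.card_union_le _ _).trans ?_)
  simp only [Set.mem_ofPred_eq] at hT hU
  omega

lemma bodyV_rep {k d : ℕ} {H : Finset (Fin k) → ℝ} (h : H ∈ bodyV k d) :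
    ∃ c : Finset (Fin k) → ℝ, (∀ S, H S = ∑ T ∈ S.powerset, c T) ∧
      ∀ T : Finset (Fin k), T.card > d → c T = 0 := by
  induction h using Submodule.span_induction with
  | mem x hx =>
    obtain ⟨U, hU, rfl⟩ := hx
    simp only [Set.mem_ofPred_eq] at hU
    refine ⟨fun T => if T = U then 1 else 0, fun S => ?_, fun T hT => ?_⟩
    · simp [chiF]
    · refine if_neg ?_
      rintro rfl
      omega
  | zero => exact ⟨0, by simp, by simp⟩
  | add x y _ _ hx hy =>
    obtain ⟨c, h1, h2⟩ := hx
    obtain ⟨c', h1', h2'⟩ := hy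
    refine ⟨c + c', fun S => ?_, fun T hT => ?_⟩
    · simp [h1, h1', Finset.sum_add_distrib]
    · simp [h2 T hT, h2' T hT]
  | smul a x _ hx =>
    obtain ⟨c, h1, h2⟩ := hx
    refine ⟨a • c, fun S => ?_, fun T hT => ?_⟩
    · simp [h1, Finset.mul_sum]
    · simp [h2 T hT]

lemma mem_stateOf' {n N : ℕ} (x : Fin n → Bool) (s : Fin N → Bool) (z : Bool)
    (i : Fin (n + N + 1)) : i ∈ stateOf x s z ↔ assignBit x s z i = true := by
  unfold stateOf
  rw [Finset.mem_filter]
  simp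

lemma one_hot {N : ℕ} (s : Fin N → Bool) (h : (1 : ℝ) - ∑ k, (if s k then (1:ℝ) else 0) = 0) :
    ∃ k, ∀ j, s j = true ↔ j = k := by
  have h1 : (∑ k, (if s k then (1:ℝ) else 0)) = ((Finset.univ.filter (fun k => s k = true)).card : ℝ) := by
    simp
  rw [h1] at h
  have h2 : (Finset.univ.filter (fun k => s k = true)).card = 1 := by
    have : ((Finset.univ.filter (fun k => s k = true)).card : ℝ) = 1 := by linarith
    exact_mod_cast this
  obtain ⟨k, hk⟩ := Finset.card_eq_one.1 h2
  refine ⟨k, fun j => ?_⟩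
  have := congrArg (fun A => j ∈ A) hk
  simpa using this

theorem two_body_ground_states_universal (n : ℕ) (f : (Fin n → Bool) → Bool) :
    ∃ (N : ℕ) (H c : Finset (Fin (n + N + 1)) → ℝ),
      (∀ S : Finset (Fin (n + N + 1)), H S = ∑ T ∈ S.powerset, c T) ∧
      (∀ T : Finset (Fin (n + N + 1)), T.card > 2 → c T = 0) ∧
      (∀ S : Finset (Fin (n + N + 1)), 0 ≤ H S) ∧
      (∀ (x : Fin n → Bool) (z : Bool),
        (∃ s : Fin N → Bool, H (stateOf x s z) = 0) ↔ z = f x) := by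
  obtain ⟨N, ⟨e⟩⟩ : ∃ N, Nonempty (Fin N ≃ (Fin n → Bool)) :=
    ⟨_, ⟨(Fintype.equivFin _).symm⟩⟩
  let inp : Fin n → Fin (n + N + 1) := fun i => ⟨i, by omega⟩
  let anc : Fin N → Fin (n + N + 1) := fun i => ⟨n + i, by omega⟩
  let out : Fin (n + N + 1) := ⟨n + N, by omega⟩
  let b : Fin (n + N + 1) → Finset (Fin (n + N + 1)) → ℝ := fun i => chiF {i}
  let L0 : Finset (Fin (n + N + 1)) → ℝ := chiF ∅ - ∑ k, b (anc k)
  let L1 : Fin n → Finset (Fin (n + N + 1)) → ℝ := fun i =>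
    b (inp i) - ∑ k, (if e k i then (1:ℝ) else 0) • b (anc k)
  let L2 : Finset (Fin (n + N + 1)) → ℝ :=
    b out - ∑ k, (if f (e k) then (1:ℝ) else 0) • b (anc k)
  let H := L0 * L0 + ∑ i, L1 i * L1 i + L2 * L2
  have hb : ∀ i, b i ∈ bodyV (n + N + 1) 1 := fun i => chiF_mem _ (by simp)
  have h0 : L0 ∈ bodyV (n + N + 1) 1 :=
    Submodule.sub_mem _ (chiF_mem _ (by simp)) (Submodule.sum_mem _ fun k _ => hb _)
  have h1 : ∀ i, L1 i ∈ bodyV (n + N + 1) 1 := fun i =>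
    Submodule.sub_mem _ (hb _) (Submodule.sum_mem _ fun k _ => Submodule.smul_mem _ _ (hb _))
  have h2 : L2 ∈ bodyV (n + N + 1) 1 :=
    Submodule.sub_mem _ (hb _) (Submodule.sum_mem _ fun k _ => Submodule.smul_mem _ _ (hb _))
  have hH : H ∈ bodyV (n + N + 1) 2 :=
    Submodule.add_mem _ (Submodule.add_mem _ (bodyV_mul h0 h0)
      (Submodule.sum_mem _ fun i _ => bodyV_mul (h1 i) (h1 i))) (bodyV_mul h2 h2)
  obtain ⟨c, hc1, hc2⟩ := bodyV_rep hH
  have hHS : ∀ S, H S = L0 S * L0 S + ∑ i, L1 i S * L1 i S + L2 S * L2 S := by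
    intro S
    simp [H]
  have hs : ∀ S, 0 ≤ ∑ i, L1 i S * L1 i S := fun S =>
    Finset.sum_nonneg fun i _ => mul_self_nonneg _
  refine ⟨N, H, c, hc1, hc2, fun S => ?_, fun x z => ?_⟩
  · rw [hHS]
    have := mul_self_nonneg (L0 S)
    have := mul_self_nonneg (L2 S)
    have := hs S
    linarith
  have hz : ∀ S, H S = 0 ↔ L0 S = 0 ∧ (∀ i, L1 i S = 0) ∧ L2 S = 0 := by
    intro S
    rw [hHS]
    constructor
    · intro h
      have a0 := mul_self_nonneg (L0 S)
      have a2 := mul_self_nonneg (L2 S)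
      have a1 := hs S
      refine ⟨mul_self_eq_zero.1 (by linarith), fun i => ?_, mul_self_eq_zero.1 (by linarith)⟩
      have : ∑ i, L1 i S * L1 i S = 0 := by linarith
      rw [Finset.sum_eq_zero_iff_of_nonneg fun i _ => mul_self_nonneg _] at this
      exact mul_self_eq_zero.1 (this i (Finset.mem_univ _))
    · rintro ⟨h0, h1, h2⟩
      simp [h0, h1, h2]
  have bi : ∀ s i, b (inp i) (stateOf x s z) = if x i then 1 else 0 := by
    intro s i
    simp [b, chiF, mem_stateOf', assignBit, inp]
  have ba : ∀ s i, b (anc i) (stateOf x s z) = if s i then 1 else 0 := by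
    intro s i
    simp [b, chiF, mem_stateOf', assignBit, anc]
  have bo : ∀ s, b out (stateOf x s z) = if z then 1 else 0 := by
    intro s
    simp [b, chiF, mem_stateOf', assignBit, out]
  have key : ∀ s, H (stateOf x s z) = 0 ↔
      (1 : ℝ) - ∑ k, (if s k then (1:ℝ) else 0) = 0 ∧
      (∀ i, (if x i then (1:ℝ) else 0) -
        ∑ k, (if e k i then (1:ℝ) else 0) * (if s k then (1:ℝ) else 0) = 0) ∧
      (if z then (1:ℝ) else 0) -
        ∑ k, (if f (e k) then (1:ℝ) else 0) * (if s k then (1:ℝ) else 0) = 0 := by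
    intro s
    rw [hz]
    simp only [L0, L1, L2, Pi.sub_apply, Finset.sum_apply, Pi.smul_apply, smul_eq_mul, bi, ba, bo]
    simp [chiF]
  have bool_eq : ∀ p q : Bool, (if p then (1:ℝ) else 0) - (if q then (1:ℝ) else 0) = 0 ↔ p = q := by
    intro p q
    cases p <;> cases q <;> simp
  have hot : ∀ (s : Fin N → Bool) (k : Fin N), (∀ j, s j = true ↔ j = k) → ∀ g : Fin N → ℝ,
      ∑ j, g j * (if s j then (1:ℝ) else 0) = g k := by
    intro s k hk g
    simp [hk]
  constructor
  · rintro ⟨s, h⟩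
    obtain ⟨k0, k1, k2⟩ := (key s).1 h
    obtain ⟨k, hk⟩ := one_hot s k0
    have hx : x = e k := by
      funext i
      have := k1 i
      rw [hot s k hk (fun j => if e j i then (1:ℝ) else 0)] at this
      exact (bool_eq _ _).1 this
    rw [hot s k hk (fun j => if f (e j) then (1:ℝ) else 0)] at k2
    rw [hx]
    exact (bool_eq _ _).1 k2
  · intro h
    refine ⟨fun j => decide (j = e.symm x), (key _).2 ⟨?_, fun i => ?_, ?_⟩⟩
    · simp
    · rw [hot _ (e.symm x) (by simp) (fun j => if e j i then (1:ℝ) else 0)]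
      simp
    · rw [hot _ (e.symm x) (by simp) (fun j => if f (e j) then (1:ℝ) else 0)]
      simp [h]
end

section
/- (Reduction of circuit satisfiability to the ground state decision problem.) Let f : (Fin n → Bool) → Bool and let H : Finset (Fin (n+N+1)) → ℝ be a Hamiltonian with H(S) ≥ 0 for all S, such that for every x : Fin n → Bool and z : Bool: (there exists s : Fin N → Bool with H(state(x,s,z)) = 0) if and only if z = f(x). Let o = n + N denote the output spin, and define the perturbed Hamiltonian H'(S) = H(S) + (1 − χ(o ∈ S)), where χ of a true proposition is 1 and of a false one is 0. Then there exists a state S with H'(S) ≤ 0 if and only if there exists an input x with f(x) = true; moreover any such S satisfies H'(S) = 0. -/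
/-- **reduction of CSAT to the ground state decision problem.**
Suppose the nonnegative Hamiltonian `H` encodes `f` in its ground states.  Let
`o = n + N` be the output spin and `H' S = H S + (1 − χ(o ∈ S))`.  Then some
state `S` has `H' S ≤ 0` iff some input `x` has `f x = true`; moreover any such
`S` satisfies `H' S = 0`. -/
theorem csat_reduces_to_ground_state_decision
    (n N : ℕ) (f : (Fin n → Bool) → Bool)
    (H : Finset (Fin (n + N + 1)) → ℝ)
    (hpos : ∀ S : Finset (Fin (n + N + 1)), 0 ≤ H S)
    (henc : ∀ (x : Fin n → Bool) (z : Bool),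
      (∃ s : Fin N → Bool, H (stateOf x s z) = 0) ↔ z = f x)
    (o : Fin (n + N + 1)) (ho : (o : ℕ) = n + N)
    (H' : Finset (Fin (n + N + 1)) → ℝ)
    (hH' : ∀ S, H' S = H S + (1 - if o ∈ S then (1 : ℝ) else 0)) :
    ((∃ S : Finset (Fin (n + N + 1)), H' S ≤ 0) ↔ ∃ x : Fin n → Bool, f x = true) ∧
    (∀ S : Finset (Fin (n + N + 1)), H' S ≤ 0 → H' S = 0) := by
  have hmem : ∀ (x : Fin n → Bool) (s : Fin N → Bool) (z : Bool) (i : Fin (n + N + 1)),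
      i ∈ stateOf x s z ↔ assignBit x s z i = true := by
    intro x s z i
    unfold stateOf
    rw [Finset.mem_filter]
    exact ⟨fun h => h.2, fun h => ⟨Finset.mem_univ _, h⟩⟩
  have key : ∀ S, H' S ≤ 0 → o ∈ S ∧ H S = 0 := by
    intro S hS
    have h1 := hH' S
    have h2 := hpos S
    by_cases h : o ∈ S
    · rw [if_pos h] at h1
      exact ⟨h, by linarith⟩
    · rw [if_neg h] at h1
      linarith
  refine ⟨⟨?_, ?_⟩, ?_⟩
  · rintro ⟨S, hS⟩
    obtain ⟨hoS, h0⟩ := key S hS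
    let x : Fin n → Bool := fun i => decide ((⟨i, by omega⟩ : Fin (n + N + 1)) ∈ S)
    let s : Fin N → Bool := fun i => decide ((⟨n + i, by omega⟩ : Fin (n + N + 1)) ∈ S)
    have hst : stateOf x s true = S := by
      ext i
      rw [hmem]
      unfold assignBit
      split_ifs with h h'
      · simp [x]
      · have hi : (⟨n + ((i : ℕ) - n), by omega⟩ : Fin (n + N + 1)) = i := by
          apply Fin.ext
          simp only
          omega
        simp only [s, decide_eq_true_eq, hi]
      · have hi : i = o := by
          apply Fin.ext
          omega
        simp [hi, hoS]
    exact ⟨x, ((henc x true).1 ⟨s, by rw [hst]; exact h0⟩).symm⟩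
  · rintro ⟨x, hx⟩
    obtain ⟨s, hs⟩ := (henc x true).2 hx.symm
    have hoS : o ∈ stateOf x s true := by
      rw [hmem]
      simp [assignBit, ho]
    refine ⟨stateOf x s true, ?_⟩
    rw [hH', if_pos hoS, hs]
    norm_num
  · intro S hS
    obtain ⟨hoS, h0⟩ := key S hS
    rw [hH', if_pos hoS, h0]
    norm_num
end
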